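/- Let p be an odd prime and let G be a finite group with center Z such that G/Z is isomorphic to the nonabelian group presented by ⟨x, y | x^{p²} = y^{p²} = 1, y x = x^{p+1} y⟩. Then the number of conjugacy classes of noncentral elements of G equals n·(p − 1)·(p + 1)², where n = |Z|/p. -/

import Mathlib

/-- Relators of the group `L₂ = ⟨x, y | x^(p²) = y^(p²) = 1, y x = x^(p+1) y⟩`,
where `x` is the generator `0` and `y` is the generator `1`. -/
def L2Rels (p : ℕ) : Set (FreeGroup (Fin 2)) :=
  {FreeGroup.of 0 ^ p ^ 2, FreeGroup.of 1 ^ p ^ 2,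
    FreeGroup.of 1 * FreeGroup.of 0 * (FreeGroup.of 0 ^ (p + 1) * FreeGroup.of 1)⁻¹}

/-- The nonabelian group `L₂` presented by
`⟨x, y | x^(p²) = y^(p²) = 1, y x = x^(p+1) y⟩`. -/
def L2 (p : ℕ) : Type := PresentedGroup (L2Rels p)

instance (p : ℕ) : Group (L2 p) := by unfold L2; infer_instance

open scoped commutatorElement

section Commutators

variable {G : Type*} [Group G]

theorem semiconjBy_mul_left_iff_commutatorElement_eq {g h u : G} :
    SemiconjBy h g (u * g) ↔ ⁅h, g⁆ = u := by
  rw [commutatorElement_def, SemiconjBy, mul_inv_eq_iff_eq_mul, mul_inv_eq_iff_eq_mul]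

theorem semiconjBy_swap {g h u : G} (H : SemiconjBy h g (u * g)) : SemiconjBy g h (u⁻¹ * h) := by
  have H' : h * g = u * g * h := H
  change g * h = u⁻¹ * h * g
  rw [mul_assoc u⁻¹, H']
  group

theorem semiconjBy_zpow_right_of_mem_center {g h u : G} (hu : u ∈ Subgroup.center G)
    (H : SemiconjBy h g (u * g)) (k : ℤ) : SemiconjBy h (g ^ k) (u ^ k * g ^ k) := by
  have hc : Commute u g := (Subgroup.mem_center_iff.1 hu g).symm
  rw [← hc.mul_zpow]
  exact H.zpow_right k

theorem semiconjBy_zpow_left_of_mem_center {g h u : G} (hu : u ∈ Subgroup.center G)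
    (H : SemiconjBy h g (u * g)) (k : ℤ) : SemiconjBy (h ^ k) g (u ^ k * g) := by
  have := semiconjBy_swap
    (inv_zpow u k ▸ semiconjBy_zpow_right_of_mem_center (inv_mem hu)
      (semiconjBy_swap H) k)
  rwa [inv_inv] at this

theorem eq_one_of_semiconjBy_of_commute {g h u : G} (H : SemiconjBy h g (u * g))
    (hc : Commute h g) : u = 1 := by
  rw [semiconjBy_mul_left_iff_commutatorElement_eq] at H
  rw [← H, commutatorElement_eq_one_iff_commute.2 hc]

/-- The preimage in `G` of the center of `G ⧸ H`. -/
abbrev centerModulo (H : Subgroup G) [H.Normal] : Subgroup G :=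
  (Subgroup.center (G ⧸ H)).comap (QuotientGroup.mk' H)

theorem commutatorElement_mem_iff_commute_mk (H : Subgroup G) [H.Normal] (g h : G) :
    ⁅h, g⁆ ∈ H ↔ Commute (QuotientGroup.mk' H h) (QuotientGroup.mk' H g) := by
  rw [← commutatorElement_eq_one_iff_commute, ← map_commutatorElement, ← MonoidHom.mem_ker,
    QuotientGroup.ker_mk']

theorem mem_centerModulo_iff {H : Subgroup G} [H.Normal] {g : G} :
    g ∈ centerModulo H ↔ ∀ h : G, ⁅h, g⁆ ∈ H := by
  simp only [commutatorElement_mem_iff_commute_mk, Subgroup.mem_comap, Subgroup.mem_center_iff]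
  constructor
  · intro h x
    exact h _
  · intro h x
    obtain ⟨y, rfl⟩ := QuotientGroup.mk'_surjective H x
    exact h y

theorem normal_of_le_center {H : Subgroup G} (hH : H ≤ Subgroup.center G) : H.Normal :=
  ⟨fun n hn g => by rwa [Subgroup.mem_center_iff.1 (hH hn) g, mul_inv_cancel_right]⟩

theorem index_eq_sq_of_zpow_mul_zpow {K : Subgroup G} [K.Normal] {a b : G} {r : ℕ} (hr : 0 < r)
    (hform : ∀ g : G, ∃ i j : ℤ, ∃ k ∈ K, g = a ^ i * b ^ j * k)
    (hmem : ∀ m n : ℤ, a ^ m * b ^ n ∈ K ↔ (r : ℤ) ∣ m ∧ (r : ℤ) ∣ n) :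
    K.index = r ^ 2 := by
  let f : Fin r × Fin r → G ⧸ K := fun q =>
    QuotientGroup.mk' K a ^ (q.1 : ℤ) * QuotientGroup.mk' K b ^ (q.2 : ℤ)
  have hmem' (m n : ℤ) : QuotientGroup.mk' K a ^ m * QuotientGroup.mk' K b ^ n = 1 ↔
      (r : ℤ) ∣ m ∧ (r : ℤ) ∣ n := by
    rw [← hmem, ← map_zpow, ← map_zpow, ← map_mul, ← MonoidHom.mem_ker, QuotientGroup.ker_mk']
  have hr' : (0 : ℤ) < r := by exact_mod_cast hr
  have hbij : Function.Bijective f := by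
    constructor
    · rintro ⟨i, j⟩ ⟨i', j'⟩ h
      have h1 : QuotientGroup.mk' K a ^ ((i : ℤ) - i') *
          QuotientGroup.mk' K b ^ ((j : ℤ) - j') = 1 := by
        have h2 : QuotientGroup.mk' K a ^ (i : ℤ) * QuotientGroup.mk' K b ^ (j : ℤ) =
          QuotientGroup.mk' K a ^ (i' : ℤ) * QuotientGroup.mk' K b ^ (j' : ℤ) := h
        rw [← mul_inv_eq_iff_eq_mul, mul_assoc] at h2
        rw [sub_eq_neg_add, zpow_add, zpow_sub, mul_assoc, h2, zpow_neg, inv_mul_cancel]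
      obtain ⟨⟨s, hs⟩, ⟨t, ht⟩⟩ := (hmem' _ _).1 h1
      have aux (x y : Fin r) (s : ℤ) (hs : (x : ℤ) - y = r * s) : x = y := by
        have hx : (x : ℤ) < r := by exact_mod_cast x.2
        have hy : (y : ℤ) < r := by exact_mod_cast y.2
        have h1 : s < 1 := by nlinarith
        have h2 : -1 < s := by nlinarith
        obtain rfl : s = 0 := by lia
        exact Fin.ext (by lia)
      rw [aux i i' s hs, aux j j' t ht]
    · intro q
      obtain ⟨g, rfl⟩ := QuotientGroup.mk'_surjective K q
      obtain ⟨i, j, k, hk, rfl⟩ := hform g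
      have hk' : QuotientGroup.mk' K k = 1 := by
        rwa [← MonoidHom.mem_ker, QuotientGroup.ker_mk']
      have har : QuotientGroup.mk' K a ^ (r : ℤ) = 1 := by simpa using (hmem' r 0).2 (by simp)
      have hbr : QuotientGroup.mk' K b ^ (r : ℤ) = 1 := by simpa using (hmem' 0 r).2 (by simp)
      have red (x : G ⧸ K) (hx : x ^ (r : ℤ) = 1) (i : ℤ) :
          x ^ ((i % r).toNat : ℤ) = x ^ i := by
        rw [Int.toNat_of_nonneg (Int.emod_nonneg _ hr'.ne')]
        conv_rhs => rw [← Int.mul_ediv_add_emod i r, zpow_add, zpow_mul, hx, one_zpow, one_mul]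
      have lt (i : ℤ) : (i % r).toNat < r := by
        have := Int.emod_lt_of_pos i hr'
        have := Int.emod_nonneg i hr'.ne'
        lia
      refine ⟨(⟨_, lt i⟩, ⟨_, lt j⟩), ?_⟩
      simp only [f, map_mul, map_zpow, hk', mul_one]
      rw [red _ har, red _ hbr]
  rw [Subgroup.index, ← Nat.card_eq_of_bijective f hbij]
  simp [sq]

end Commutators

section ConjugacyClasses

variable {G : Type*} [Group G]

/-- The conjugacy class of `x`. -/
abbrev conjSet (x : G) : Set G := {y | ∃ g, y = g⁻¹ * x * g}

theorem conj_mem_conjSet (x h : G) : h * x * h⁻¹ ∈ conjSet x := ⟨h⁻¹, by simp⟩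

theorem conjSet_eq_iff {x y : G} : conjSet y = conjSet x ↔ y ∈ conjSet x := by
  constructor
  · intro h
    rw [← h]
    exact ⟨1, by simp⟩
  · rintro ⟨g, rfl⟩
    ext z
    constructor
    · rintro ⟨h, rfl⟩
      exact ⟨g * h, by group⟩
    · rintro ⟨h, rfl⟩
      exact ⟨g⁻¹ * h, by group⟩

theorem conjSet_subset_image_mul {H : Subgroup G} {g : G} (h : ∀ x : G, ⁅x, g⁆ ∈ H) :
    conjSet g ⊆ (· * g) '' (H : Set G) := by
  rintro _ ⟨x, rfl⟩
  exact ⟨⁅x⁻¹, g⁆, h _, by simp [commutatorElement_def]⟩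

theorem ncard_conjSet_dvd_index_center (x : G) :
    (conjSet x).ncard ∣ (Subgroup.center G).index := by
  have h : conjSet x = MulAction.orbit (ConjAct G) x := by
    ext y
    rw [ConjAct.mem_orbit_conjAct, isConj_iff]
    constructor
    · rintro ⟨g, rfl⟩
      exact ⟨g, by group⟩
    · rintro ⟨g, rfl⟩
      exact ⟨g, by group⟩
  rw [h, ← MulAction.index_stabilizer, ConjAct.stabilizer_eq_centralizer]
  exact Subgroup.index_dvd_of_le (Subgroup.center_le_centralizer _)

theorem mul_ncard_image_conjSet [Finite G] {S : Set G} {d : ℕ}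
    (hS : ∀ x ∈ S, conjSet x ⊆ S) (hd : ∀ x ∈ S, (conjSet x).ncard = d) :
    d * (conjSet '' S).ncard = S.ncard := by
  classical
  have hfin := S.toFinite
  rw [Set.ncard_eq_toFinset_card S hfin, Finset.card_eq_sum_card_image conjSet hfin.toFinset]
  rw [Finset.sum_const_nat (m := d)]
  · rw [mul_comm, ← Set.ncard_coe_finset]
    simp
  · intro C hC
    obtain ⟨x, hx, rfl⟩ := Finset.mem_image.1 hC
    have hx' : x ∈ S := by simpa using hx
    rw [← hd x hx', ← Set.ncard_coe_finset]
    congr 1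
    ext y
    simp only [Finset.coe_filter, Set.Finite.mem_toFinset, conjSet_eq_iff]
    exact ⟨fun h => h.2, fun h => ⟨hS x hx' h, h⟩⟩

end ConjugacyClasses

/-- Lifts `a`, `b` to `G` of the standard generators of `G ⧸ Z(G) ≃* L2 p`, with `c` the
commutator of `b` and `a`. -/
structure IsL2Lift {G : Type*} [Group G] (p : ℕ) (a b c : G) : Prop where
  prime : p.Prime
  odd : Odd p
  conj : SemiconjBy b a (c * a)
  exists_eq : ∃ z ∈ Subgroup.center G, c = z * a ^ p
  pow_mem_center : c ^ p ∈ Subgroup.center G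
  notMem_center : c ∉ Subgroup.center G
  gen : ∀ H : Subgroup G, a ∈ H → b ∈ H → Subgroup.center G ≤ H → H = ⊤

namespace IsL2Lift

variable {G : Type*} [Group G] {p : ℕ} {a b c : G}

theorem commutatorElement_mem (hL : IsL2Lift p a b c) {H : Subgroup G} [H.Normal] {g : G}
    (ha : ⁅a, g⁆ ∈ H) (hb : ⁅b, g⁆ ∈ H) (h : G) : ⁅h, g⁆ ∈ H := by
  have key := hL.gen ((Subgroup.centralizer {QuotientGroup.mk' H g}).comap (QuotientGroup.mk' H))
  simp only [Subgroup.mem_comap, Subgroup.mem_centralizer_singleton_iff] at key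
  rw [commutatorElement_mem_iff_commute_mk] at ha hb ⊢
  have : h ∈ (Subgroup.centralizer {QuotientGroup.mk' H g}).comap (QuotientGroup.mk' H) := by
    rw [key ha hb]
    · trivial
    · intro z hz
      rw [Subgroup.mem_comap, Subgroup.mem_centralizer_singleton_iff, ← map_mul, ← map_mul,
        Subgroup.mem_center_iff.1 hz g]
  exact Subgroup.mem_centralizer_singleton_iff.1 this

theorem mem_center (hL : IsL2Lift p a b c) {g : G} (ha : Commute a g) (hb : Commute b g) :
    g ∈ Subgroup.center G := by
  refine Subgroup.mem_center_iff.2 fun h => ?_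
  have := hL.commutatorElement_mem (H := ⊥) (g := g)
    (by rwa [Subgroup.mem_bot, commutatorElement_eq_one_iff_commute])
    (by rwa [Subgroup.mem_bot, commutatorElement_eq_one_iff_commute]) h
  rwa [Subgroup.mem_bot, commutatorElement_eq_one_iff_commute] at this

theorem commute_a_c (hL : IsL2Lift p a b c) : Commute a c := by
  obtain ⟨z, hz, rfl⟩ := hL.exists_eq
  exact Commute.mul_right (Subgroup.mem_center_iff.1 hz a) (Commute.self_pow a p)

theorem semiconjBy_c (hL : IsL2Lift p a b c) : SemiconjBy b c (c ^ p * c) := by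
  obtain ⟨z, hz, hc⟩ := hL.exists_eq
  have h1 : SemiconjBy b (z * a ^ p) (z * (c * a) ^ p) :=
    SemiconjBy.mul_right (Subgroup.mem_center_iff.1 hz b) (hL.conj.pow_right p)
  have h2 : z * (c * a) ^ p = c ^ p * (z * a ^ p) := by
    rw [hL.commute_a_c.symm.mul_pow, ← mul_assoc, ← mul_assoc,
      Subgroup.mem_center_iff.1 hz (c ^ p)]
  rwa [h2, ← hc] at h1

theorem semiconjBy_a_pow (hL : IsL2Lift p a b c) : SemiconjBy b (a ^ p) (c ^ p * a ^ p) := by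
  rw [← hL.commute_a_c.symm.mul_pow]
  exact hL.conj.pow_right p

theorem pow_pow_eq_one (hL : IsL2Lift p a b c) : (c ^ p) ^ p = 1 := by
  have h := semiconjBy_zpow_right_of_mem_center hL.pow_mem_center hL.semiconjBy_c p
  rw [zpow_natCast, zpow_natCast] at h
  exact eq_one_of_semiconjBy_of_commute h (Subgroup.mem_center_iff.1 hL.pow_mem_center b)

theorem orderOf_pow (hL : IsL2Lift p a b c) : orderOf (c ^ p) = p := by
  have := Fact.mk hL.prime
  refine orderOf_eq_prime hL.pow_pow_eq_one fun h => hL.notMem_center ?_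
  have hb := hL.semiconjBy_c
  rw [h, one_mul] at hb
  exact hL.mem_center hL.commute_a_c hb

theorem semiconjBy_b_pow (hL : IsL2Lift p a b c) : SemiconjBy (b ^ p) a (c ^ p * a) := by
  have key (n : ℕ) : SemiconjBy (b ^ n) a ((c ^ p) ^ n.choose 2 * c ^ n * a) := by
    induction n with
    | zero => simp
    | succ n ih =>
      rw [pow_succ']
      refine SemiconjBy.mul_left ?_ ih
      have h := SemiconjBy.mul_right (SemiconjBy.mul_right
        (Subgroup.mem_center_iff.1 (pow_mem hL.pow_mem_center (n.choose 2)) b)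
        (hL.semiconjBy_c.pow_right n)) hL.conj
      convert h using 1
      rw [((Commute.refl c).pow_left p).mul_pow, Nat.choose_succ_succ' n 1, Nat.choose_one_right,
        add_comm n (n.choose _), pow_add, pow_succ c n]
      simp only [mul_assoc]
  have h := key p
  obtain ⟨k, hk⟩ := hL.odd
  have h2 : p.choose 2 = p * k := by
    rw [Nat.choose_two_right, hk, Nat.add_sub_cancel, mul_left_comm,
      Nat.mul_div_cancel_left _ two_pos]
  rwa [h2, pow_mul, hL.pow_pow_eq_one, one_pow, one_mul] at h

theorem zpowers_le_center (hL : IsL2Lift p a b c) :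
    Subgroup.zpowers (c ^ p) ≤ Subgroup.center G :=
  Subgroup.zpowers_le.2 hL.pow_mem_center

theorem zpow_eq_one_iff (hL : IsL2Lift p a b c) (n : ℤ) : (c ^ p) ^ n = 1 ↔ (p : ℤ) ∣ n := by
  rw [← orderOf_dvd_iff_zpow_eq_one, hL.orderOf_pow]

theorem normal_zpowers_pow (hL : IsL2Lift p a b c) : (Subgroup.zpowers (c ^ p)).Normal :=
  normal_of_le_center hL.zpowers_le_center

theorem a_pow_mem [(Subgroup.zpowers (c ^ p)).Normal] (hL : IsL2Lift p a b c) :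
    a ^ p ∈ centerModulo (Subgroup.zpowers (c ^ p)) := by
  refine mem_centerModulo_iff.2 (hL.commutatorElement_mem ?_ ?_)
  · rw [commutatorElement_eq_one_iff_commute.2 (Commute.self_pow a p)]
    exact one_mem _
  · rw [semiconjBy_mul_left_iff_commutatorElement_eq.1 hL.semiconjBy_a_pow]
    exact Subgroup.mem_zpowers _

theorem c_mem [(Subgroup.zpowers (c ^ p)).Normal] (hL : IsL2Lift p a b c) :
    c ∈ centerModulo (Subgroup.zpowers (c ^ p)) := by
  refine mem_centerModulo_iff.2 (hL.commutatorElement_mem ?_ ?_)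
  · rw [commutatorElement_eq_one_iff_commute.2 hL.commute_a_c]
    exact one_mem _
  · rw [semiconjBy_mul_left_iff_commutatorElement_eq.1 hL.semiconjBy_c]
    exact Subgroup.mem_zpowers _

theorem b_pow_mem [(Subgroup.zpowers (c ^ p)).Normal] (hL : IsL2Lift p a b c) :
    b ^ p ∈ centerModulo (Subgroup.zpowers (c ^ p)) := by
  refine mem_centerModulo_iff.2 (hL.commutatorElement_mem ?_ ?_)
  · rw [← inv_mem_iff, commutatorElement_inv,
      semiconjBy_mul_left_iff_commutatorElement_eq.1 hL.semiconjBy_b_pow]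
    exact Subgroup.mem_zpowers _
  · rw [commutatorElement_eq_one_iff_commute.2 (Commute.self_pow b p)]
    exact one_mem _

theorem center_le [(Subgroup.zpowers (c ^ p)).Normal] :
    Subgroup.center G ≤ centerModulo (Subgroup.zpowers (c ^ p)) := by
  intro z hz
  refine mem_centerModulo_iff.2 fun h => ?_
  rw [commutatorElement_eq_one_iff_commute.2 (Subgroup.mem_center_iff.1 hz h)]
  exact one_mem _

/-- An element whose commutators with `a` and `b` lie in `⟨c ^ p⟩` commutes with `c`
and `b ^ p`. -/
theorem commute_of_commutatorElement_mem (hL : IsL2Lift p a b c) {g : G}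
    (ha : ⁅a, g⁆ ∈ Subgroup.zpowers (c ^ p)) (hb : ⁅b, g⁆ ∈ Subgroup.zpowers (c ^ p)) :
    Commute g c ∧ Commute g (b ^ p) := by
  obtain ⟨i, hi⟩ := ha
  obtain ⟨j, hj⟩ := hb
  have hci := zpow_mem hL.pow_mem_center i
  have hcj := zpow_mem hL.pow_mem_center j
  have hi := semiconjBy_swap
    (semiconjBy_mul_left_iff_commutatorElement_eq.2 hi.symm)
  have hj := semiconjBy_swap
    (semiconjBy_mul_left_iff_commutatorElement_eq.2 hj.symm)
  constructor
  · have hc : c = b * a * b⁻¹ * a⁻¹ := by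
      rw [← commutatorElement_def, semiconjBy_mul_left_iff_commutatorElement_eq.1 hL.conj]
    have h := ((hj.mul_right hi).mul_right hj.inv_right).mul_right hi.inv_right
    have hz (u x : G) (hu : u ∈ Subgroup.center G) : x * u = u * x :=
      Subgroup.mem_center_iff.1 hu x
    have e : ((c ^ p) ^ j)⁻¹ * b * (((c ^ p) ^ i)⁻¹ * a) * (((c ^ p) ^ j)⁻¹ * b)⁻¹ *
        (((c ^ p) ^ i)⁻¹ * a)⁻¹ = b * a * b⁻¹ * a⁻¹ := by
      have h1 := hz _ b (inv_mem hci)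
      have h2 := hz _ (b * a * b⁻¹) hcj
      have h3 := hz _ (b * a * b⁻¹ * a⁻¹) hci
      have h4 := hz _ ((c ^ p) ^ i)⁻¹ hcj
      generalize (c ^ p) ^ i = u at *
      generalize (c ^ p) ^ j = v at *
      calc v⁻¹ * b * (u⁻¹ * a) * (v⁻¹ * b)⁻¹ * (u⁻¹ * a)⁻¹
          = v⁻¹ * (b * u⁻¹) * a * b⁻¹ * v * a⁻¹ * u := by group
        _ = v⁻¹ * u⁻¹ * (b * a * b⁻¹ * v) * a⁻¹ * u := by rw [h1]; group
        _ = v⁻¹ * (u⁻¹ * v) * (b * a * b⁻¹ * a⁻¹ * u) := by rw [h2]; group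
        _ = b * a * b⁻¹ * a⁻¹ := by rw [h3, h4]; group
    rw [e, ← hc] at h
    exact h
  · have h := semiconjBy_zpow_right_of_mem_center (inv_mem hcj) hj p
    rw [inv_zpow, ← zpow_mul, mul_comm j, zpow_mul, zpow_natCast (c ^ p), hL.pow_pow_eq_one,
      one_zpow, inv_one, one_mul, zpow_natCast] at h
    exact h

theorem dvd_of_commute_c (hL : IsL2Lift p a b c) {m n : ℤ} (h : Commute (a ^ m * b ^ n) c) :
    (p : ℤ) ∣ n := by
  rw [← hL.zpow_eq_one_iff]
  have h1 := semiconjBy_zpow_left_of_mem_center hL.pow_mem_center hL.semiconjBy_c n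
  have h2 : SemiconjBy (a ^ m) ((c ^ p) ^ n * c) ((c ^ p) ^ n * c) :=
    SemiconjBy.mul_right (Subgroup.mem_center_iff.1 (zpow_mem hL.pow_mem_center n) _)
      (hL.commute_a_c.zpow_left m)
  exact eq_one_of_semiconjBy_of_commute (h2.mul_left h1) h

theorem dvd_of_commute_b_pow (hL : IsL2Lift p a b c) {m n : ℤ}
    (h : Commute (a ^ m * b ^ n) (b ^ p)) : (p : ℤ) ∣ m := by
  rw [← hL.zpow_eq_one_iff]
  have h1 := semiconjBy_zpow_right_of_mem_center hL.pow_mem_center hL.semiconjBy_b_pow m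
  have h2 : SemiconjBy (b ^ p) (b ^ n) (b ^ n) := ((Commute.refl b).pow_left p).zpow_right n
  have h3 := h1.mul_right h2
  rw [mul_assoc] at h3
  exact eq_one_of_semiconjBy_of_commute h3 h.symm

theorem zpow_mul_zpow_mem_centerModulo [(Subgroup.zpowers (c ^ p)).Normal]
    (hL : IsL2Lift p a b c) {m n : ℤ} (hm : (p : ℤ) ∣ m) (hn : (p : ℤ) ∣ n) :
    a ^ m * b ^ n ∈ centerModulo (Subgroup.zpowers (c ^ p)) := by
  obtain ⟨m, rfl⟩ := hm
  obtain ⟨n, rfl⟩ := hn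
  rw [zpow_mul, zpow_mul, zpow_natCast, zpow_natCast]
  exact mul_mem (zpow_mem hL.a_pow_mem m) (zpow_mem hL.b_pow_mem n)

theorem commute_of_mem [(Subgroup.zpowers (c ^ p)).Normal] (hL : IsL2Lift p a b c) {g : G}
    (hg : g ∈ centerModulo (Subgroup.zpowers (c ^ p))) : Commute g c ∧ Commute g (b ^ p) :=
  hL.commute_of_commutatorElement_mem (mem_centerModulo_iff.1 hg a) (mem_centerModulo_iff.1 hg b)

theorem zpow_mul_zpow_mem_centerModulo_iff [(Subgroup.zpowers (c ^ p)).Normal]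
    (hL : IsL2Lift p a b c) (m n : ℤ) :
    a ^ m * b ^ n ∈ centerModulo (Subgroup.zpowers (c ^ p)) ↔ (p : ℤ) ∣ m ∧ (p : ℤ) ∣ n := by
  refine ⟨fun h => ?_, fun h => hL.zpow_mul_zpow_mem_centerModulo h.1 h.2⟩
  have := hL.commute_of_mem h
  exact ⟨hL.dvd_of_commute_b_pow this.2, hL.dvd_of_commute_c this.1⟩

theorem zpow_mul_zpow_mem_center_iff (hL : IsL2Lift p a b c) (m n : ℤ) :
    a ^ m * b ^ n ∈ Subgroup.center G ↔ ((p ^ 2 : ℕ) : ℤ) ∣ m ∧ ((p ^ 2 : ℕ) : ℤ) ∣ n := by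
  have hp0 : (p : ℤ) ≠ 0 := by exact_mod_cast hL.prime.ne_zero
  push_cast
  have semi_a (m n : ℤ) : SemiconjBy (a ^ m * b ^ (p * n)) a ((c ^ p) ^ n * a) := by
    have h1 := semiconjBy_zpow_left_of_mem_center hL.pow_mem_center hL.semiconjBy_b_pow n
    rw [← zpow_natCast b p, ← zpow_mul] at h1
    exact SemiconjBy.mul_left (SemiconjBy.mul_right
      (Subgroup.mem_center_iff.1 (zpow_mem hL.pow_mem_center n) _) (Commute.zpow_self a m)) h1
  have semi_b (m n : ℤ) : SemiconjBy b (a ^ (p * m) * b ^ n)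
      ((c ^ p) ^ m * (a ^ (p * m) * b ^ n)) := by
    have h1 := semiconjBy_zpow_right_of_mem_center hL.pow_mem_center hL.semiconjBy_a_pow m
    rw [← zpow_natCast a p, ← zpow_mul] at h1
    rw [← mul_assoc]
    exact h1.mul_right (Commute.self_zpow b n)
  constructor
  · intro h
    have hall := Subgroup.mem_center_iff.1 h
    obtain ⟨m, rfl⟩ := hL.dvd_of_commute_b_pow (hall (b ^ p)).symm
    obtain ⟨n, rfl⟩ := hL.dvd_of_commute_c (hall c).symm
    rw [sq, mul_dvd_mul_iff_left hp0, mul_dvd_mul_iff_left hp0, ← hL.zpow_eq_one_iff,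
      ← hL.zpow_eq_one_iff]
    exact ⟨eq_one_of_semiconjBy_of_commute (semi_b m _) (hall b),
      eq_one_of_semiconjBy_of_commute (semi_a _ n) (hall a).symm⟩
  · rintro ⟨⟨m, rfl⟩, ⟨n, rfl⟩⟩
    rw [sq, mul_assoc, mul_assoc]
    have ha := semi_a (p * (p * m)) (p * n)
    have hb := semi_b (p * m) (p * (p * n))
    rw [(hL.zpow_eq_one_iff _).2 (dvd_mul_right _ _), one_mul] at ha hb
    exact hL.mem_center (SemiconjBy.eq ha).symm hb

theorem normal_of_conj_mem [Finite G] (hL : IsL2Lift p a b c) {H : Subgroup G}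
    (ha : ∀ h ∈ H, a * h * a⁻¹ ∈ H) (hb : ∀ h ∈ H, b * h * b⁻¹ ∈ H) : H.Normal := by
  rw [← Subgroup.normalizer_eq_top_iff]
  refine hL.gen _ (Subgroup.mem_normalizer_fintype ha) (Subgroup.mem_normalizer_fintype hb) ?_
  exact Subgroup.center_le_normalizer _

theorem exists_eq_zpow_mul_zpow_mul [Finite G] (hL : IsL2Lift p a b c) (g : G) :
    ∃ i j : ℤ, ∃ k ∈ Subgroup.center G, g = a ^ i * b ^ j * k := by
  have hz (z : G) (hz : z ∈ Subgroup.center G) (x : G) : x * z = z * x :=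
    Subgroup.mem_center_iff.1 hz x
  have hn : (Subgroup.zpowers a ⊔ Subgroup.center G).Normal := by
    refine hL.normal_of_conj_mem ?_ ?_
    · intro h hh
      have ha : a ∈ Subgroup.zpowers a ⊔ Subgroup.center G :=
        Subgroup.mem_sup_left (Subgroup.mem_zpowers a)
      exact mul_mem (mul_mem ha hh) (inv_mem ha)
    · intro h hh
      obtain ⟨x, hx, z, hz', rfl⟩ := Subgroup.mem_sup_of_normal_right.1 hh
      obtain ⟨i, rfl⟩ := Subgroup.mem_zpowers_iff.1 hx
      obtain ⟨u, hu, hc⟩ := hL.exists_eq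
      have h1 : b * (a ^ i * z) * b⁻¹ = (u * a ^ p * a) ^ i * z := by
        rw [← hc, mul_inv_eq_iff_eq_mul, ← mul_assoc, (hL.conj.zpow_right i).eq, mul_assoc,
          mul_assoc, hz z hz' b]
      rw [h1]
      have ha : a ∈ Subgroup.zpowers a ⊔ Subgroup.center G :=
        Subgroup.mem_sup_left (Subgroup.mem_zpowers a)
      exact mul_mem (zpow_mem (mul_mem (mul_mem (Subgroup.mem_sup_right hu) (pow_mem ha p)) ha) i)
        (Subgroup.mem_sup_right hz')
  have htop := hL.gen ((Subgroup.zpowers a ⊔ Subgroup.center G) ⊔ Subgroup.zpowers b)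
    (Subgroup.mem_sup_left (Subgroup.mem_sup_left (Subgroup.mem_zpowers a)))
    (Subgroup.mem_sup_right (Subgroup.mem_zpowers b)) (le_sup_of_le_left le_sup_right)
  have hg : g ∈ (Subgroup.zpowers a ⊔ Subgroup.center G) ⊔ Subgroup.zpowers b := by
    rw [htop]; trivial
  obtain ⟨x, hx, y, hy, rfl⟩ := Subgroup.mem_sup_of_normal_left.1 hg
  obtain ⟨w, hw, z, hz', rfl⟩ := Subgroup.mem_sup_of_normal_right.1 hx
  obtain ⟨i, rfl⟩ := Subgroup.mem_zpowers_iff.1 hw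
  obtain ⟨j, rfl⟩ := Subgroup.mem_zpowers_iff.1 hy
  exact ⟨i, j, z, hz', by rw [mul_assoc, ← hz z hz' (b ^ j), mul_assoc]⟩

theorem index_center [Finite G] (hL : IsL2Lift p a b c) :
    (Subgroup.center G).index = (p ^ 2) ^ 2 :=
  index_eq_sq_of_zpow_mul_zpow (pow_pos hL.prime.pos 2) hL.exists_eq_zpow_mul_zpow_mul
    hL.zpow_mul_zpow_mem_center_iff

theorem index_centerModulo [Finite G] [(Subgroup.zpowers (c ^ p)).Normal]
    (hL : IsL2Lift p a b c) :
    (centerModulo (Subgroup.zpowers (c ^ p))).index = p ^ 2 := by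
  refine index_eq_sq_of_zpow_mul_zpow hL.prime.pos (fun g => ?_)
    hL.zpow_mul_zpow_mem_centerModulo_iff
  obtain ⟨i, j, k, hk, rfl⟩ := hL.exists_eq_zpow_mul_zpow_mul g
  exact ⟨i, j, k, center_le hk, rfl⟩

theorem mem_of_commute [Finite G] [(Subgroup.zpowers (c ^ p)).Normal] (hL : IsL2Lift p a b c)
    {g : G} (hc : Commute g c) (hb : Commute g (b ^ p)) :
    g ∈ centerModulo (Subgroup.zpowers (c ^ p)) := by
  obtain ⟨i, j, k, hk, rfl⟩ := hL.exists_eq_zpow_mul_zpow_mul g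
  have hk' (x : G) : Commute k⁻¹ x := ((Subgroup.mem_center_iff.1 (inv_mem hk)) x).symm
  have hc' := hc.mul_left (hk' c)
  have hb' := hb.mul_left (hk' (b ^ p))
  rw [mul_inv_cancel_right] at hc' hb'
  exact mul_mem (hL.zpow_mul_zpow_mem_centerModulo (hL.dvd_of_commute_b_pow hb')
    (hL.dvd_of_commute_c hc')) (center_le hk)

theorem ncard_zpowers_pow_mul (hL : IsL2Lift p a b c) (g : G) :
    ((· * g) '' (Subgroup.zpowers (c ^ p) : Set G)).ncard = p := by
  rw [Set.ncard_image_of_injective _ (mul_left_injective g), ← Nat.card_coe_set_eq]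
  exact (Nat.card_zpowers _).trans hL.orderOf_pow

theorem ncard_zpowers_mul_le (hL : IsL2Lift p a b c) (g : G) :
    ((· * g) '' (Subgroup.zpowers c : Set G)).ncard ≤ p ^ 2 := by
  rw [Set.ncard_image_of_injective _ (mul_left_injective g), ← Nat.card_coe_set_eq]
  refine (Nat.card_zpowers c).trans_le (orderOf_le_of_pow_eq_one (pow_pos hL.prime.pos 2) ?_)
  rw [sq, pow_mul, hL.pow_pow_eq_one]

theorem ncard_conjSet_of_mem_centerModulo [Finite G] [(Subgroup.zpowers (c ^ p)).Normal]
    (hL : IsL2Lift p a b c) {g : G} (hg : g ∈ centerModulo (Subgroup.zpowers (c ^ p)))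
    (hg' : g ∉ Subgroup.center G) : (conjSet g).ncard = p := by
  have hle : (conjSet g).ncard ≤ p := by
    rw [← hL.ncard_zpowers_pow_mul g]
    exact Set.ncard_le_ncard (conjSet_subset_image_mul (mem_centerModulo_iff.1 hg)) (Set.toFinite _)
  have hlt : 1 < (conjSet g).ncard := by
    rw [Set.one_lt_ncard (Set.toFinite _)]
    by_contra! H
    refine hg' (Subgroup.mem_center_iff.2 fun h => ?_)
    rw [← mul_inv_eq_iff_eq_mul]
    exact H _ (conj_mem_conjSet g h) _ ⟨1, by simp⟩
  have hdvd := ncard_conjSet_dvd_index_center g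
  rw [hL.index_center, ← pow_mul, Nat.dvd_prime_pow hL.prime] at hdvd
  obtain ⟨k, -, hk⟩ := hdvd
  rw [hk] at hle hlt ⊢
  have h1 : k ≤ 1 := (Nat.pow_le_pow_iff_right hL.prime.one_lt).1 (by simpa using hle)
  interval_cases k
  · simp at hlt
  · simp

theorem normal_zpowers [Finite G] (hL : IsL2Lift p a b c) : (Subgroup.zpowers c).Normal := by
  have aux (x : G) (k : ℕ) (hx : SemiconjBy x c (c ^ k)) :
      ∀ h ∈ Subgroup.zpowers c, x * h * x⁻¹ ∈ Subgroup.zpowers c := by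
    rintro _ ⟨i, rfl⟩
    rw [(hx.zpow_right i).eq, mul_inv_cancel_right]
    exact zpow_mem (pow_mem (Subgroup.mem_zpowers c) k) i
  refine hL.normal_of_conj_mem (aux a 1 ?_) (aux b (p + 1) (pow_succ c p ▸ hL.semiconjBy_c))
  rw [pow_one]
  exact hL.commute_a_c

theorem commutatorElement_mem_zpowers [Finite G] (hL : IsL2Lift p a b c) (g h : G) :
    ⁅h, g⁆ ∈ Subgroup.zpowers c := by
  have := hL.normal_zpowers
  have hba : ⁅b, a⁆ ∈ Subgroup.zpowers c := by
    rw [semiconjBy_mul_left_iff_commutatorElement_eq.1 hL.conj]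
    exact Subgroup.mem_zpowers c
  have ha := hL.commutatorElement_mem (H := Subgroup.zpowers c) (g := a) (by simp) hba g
  have hb := hL.commutatorElement_mem (H := Subgroup.zpowers c) (g := b)
    (by rw [← inv_mem_iff, commutatorElement_inv]; exact hba) (by simp) g
  rw [← inv_mem_iff, commutatorElement_inv] at ha hb
  exact hL.commutatorElement_mem ha hb h

theorem zpowers_mul_subset_conjSet (hL : IsL2Lift p a b c)
    {g h : G} (hh : ⁅h, g⁆ ∈ Subgroup.zpowers (c ^ p)) (hne : ¬ Commute h g) :
    (· * g) '' (Subgroup.zpowers (c ^ p) : Set G) ⊆ conjSet g := by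
  have := Fact.mk hL.prime
  have hcard : Nat.card (Subgroup.zpowers (c ^ p)) = p :=
    (Nat.card_zpowers _).trans hL.orderOf_pow
  rintro _ ⟨v, hv, rfl⟩
  have hmem := mem_zpowers_of_prime_card hcard (g := ⟨_, hh⟩) (g' := ⟨v, hv⟩)
    (by simpa [Subtype.ext_iff, commutatorElement_eq_one_iff_commute] using hne)
  obtain ⟨k, hk⟩ := hmem
  have hk : ⁅h, g⁆ ^ k = v := congrArg Subtype.val hk
  have h1 := semiconjBy_zpow_left_of_mem_center (hL.zpowers_le_center hh)
    (semiconjBy_mul_left_iff_commutatorElement_eq.2 rfl) k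
  have h2 : v * g = h ^ k * g * (h ^ k)⁻¹ := by
    rw [h1.eq, hk, mul_inv_cancel_right]
  change v * g ∈ conjSet g
  rw [h2]
  exact conj_mem_conjSet g _

theorem ncard_conjSet_of_notMem_centerModulo [Finite G] [(Subgroup.zpowers (c ^ p)).Normal]
    (hL : IsL2Lift p a b c) {g : G} (hg : g ∉ centerModulo (Subgroup.zpowers (c ^ p))) :
    (conjSet g).ncard = p ^ 2 := by
  have hle : (conjSet g).ncard ≤ p ^ 2 :=
    (Set.ncard_le_ncard (conjSet_subset_image_mul (hL.commutatorElement_mem_zpowers g))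
      (Set.toFinite _)).trans (hL.ncard_zpowers_mul_le g)
  have hlt : p < (conjSet g).ncard := by
    rw [← hL.ncard_zpowers_pow_mul g]
    refine Set.ncard_lt_ncard ((Set.ssubset_iff_of_subset ?_).2 ?_) (Set.toFinite _)
    · obtain ⟨h, hh, hne⟩ : ∃ h ∈ centerModulo (Subgroup.zpowers (c ^ p)), ¬ Commute h g := by
        by_contra! H
        exact hg (hL.mem_of_commute (H c hL.c_mem).symm (H _ hL.b_pow_mem).symm)
      refine hL.zpowers_mul_subset_conjSet ?_ hne
      rw [← inv_mem_iff, commutatorElement_inv]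
      exact mem_centerModulo_iff.1 hh g
    · by_contra! H
      refine hg (mem_centerModulo_iff.2 fun h => ?_)
      obtain ⟨v, hv, hvg⟩ := H _ (conj_mem_conjSet g h)
      have : ⁅h, g⁆ = v := by
        rw [commutatorElement_def, ← hvg, mul_inv_cancel_right]
      exact this ▸ hv
  have hdvd := ncard_conjSet_dvd_index_center g
  rw [hL.index_center, ← pow_mul, Nat.dvd_prime_pow hL.prime] at hdvd
  obtain ⟨k, -, hk⟩ := hdvd
  rw [hk] at hle hlt ⊢
  have h1 : k ≤ 2 := (Nat.pow_le_pow_iff_right hL.prime.one_lt).1 hle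
  have h2 : 1 < k := (Nat.pow_lt_pow_iff_right hL.prime.one_lt).1 (by simpa using hlt)
  obtain rfl : k = 2 := by lia
  rfl

theorem ncard_noncentral [Finite G] (hL : IsL2Lift p a b c) :
    (conjSet '' {x : G | x ∉ Subgroup.center G}).ncard
      = (Nat.card (Subgroup.center G) / p) * (p - 1) * (p + 1) ^ 2 := by
  have := hL.normal_zpowers_pow
  set N := centerModulo (Subgroup.zpowers (c ^ p))
  set Z := Subgroup.center G
  have hZN : Z ≤ N := center_le
  have closed (K : Subgroup G) [K.Normal] {x y : G} (hy : y ∈ conjSet x) : y ∈ K ↔ x ∈ K := by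
    obtain ⟨g, rfl⟩ := hy
    rw [mul_assoc, Subgroup.Normal.mem_comm_iff inferInstance, mul_inv_cancel_right]
  have h1 := mul_ncard_image_conjSet (S := (N : Set G) \ Z) (d := p)
    (fun x hx y hy => ⟨(closed N hy).2 hx.1, fun h => hx.2 ((closed Z hy).1 h)⟩)
    (fun x hx => hL.ncard_conjSet_of_mem_centerModulo hx.1 hx.2)
  have h2 := mul_ncard_image_conjSet (S := (N : Set G)ᶜ) (d := p ^ 2)
    (fun x hx y hy h => hx ((closed N hy).1 h))
    (fun x hx => hL.ncard_conjSet_of_notMem_centerModulo hx)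
  have hunion : {x : G | x ∉ Z} = ((N : Set G) \ Z) ∪ (N : Set G)ᶜ := by
    ext x
    have := @hZN x
    simp only [Set.mem_ofPred, Set.mem_union, Set.mem_sdiff, SetLike.mem_coe, Set.mem_compl_iff]
    tauto
  have hdisj : Disjoint (conjSet '' ((N : Set G) \ Z)) (conjSet '' (N : Set G)ᶜ) := by
    rw [Set.disjoint_left]
    rintro _ ⟨x, hx, rfl⟩ ⟨y, hy, hxy⟩
    exact hy ((closed N (conjSet_eq_iff.1 hxy)).2 hx.1)
  rw [hunion, Set.image_union, Set.ncard_union_eq hdisj (Set.toFinite _) (Set.toFinite _)]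
  have cN : (N : Set G).ncard = Nat.card N := (Nat.card_coe_set_eq _).symm
  have cZ : (Z : Set G).ncard = Nat.card Z := (Nat.card_coe_set_eq _).symm
  have hd := Set.ncard_sdiff_add_ncard_of_subset (s := (Z : Set G)) (t := N) hZN
  have hc := Set.ncard_add_ncard_compl (N : Set G)
  rw [cN, cZ] at hd
  rw [cN] at hc
  have iN := N.card_mul_index
  have iZ := Z.card_mul_index
  rw [hL.index_centerModulo] at iN
  rw [hL.index_center] at iZ
  obtain ⟨n, hn⟩ : p ∣ Nat.card Z := by
    have := Subgroup.card_dvd_of_le hL.zpowers_le_center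
    rwa [Nat.card_zpowers, hL.orderOf_pow] at this
  have hp := hL.prime.pos
  obtain ⟨q, rfl⟩ : ∃ q, p = q + 1 := ⟨p - 1, by lia⟩
  rw [hn, Nat.mul_div_cancel_left _ hp, Nat.add_sub_cancel]
  rw [hn] at hd iZ
  generalize (conjSet '' ((N : Set G) \ Z)).ncard = A at *
  generalize (conjSet '' (N : Set G)ᶜ).ncard = B at *
  rw [← h1] at hd
  rw [← h2] at hc
  have hN' : Nat.card N = (q + 1) ^ 3 * n :=
    Nat.eq_of_mul_eq_mul_right (pow_pos hp 2) (by rw [iN, ← iZ]; ring)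
  rw [hN'] at hd hc
  rw [← iZ] at hc
  have hA : A + n = (q + 1) ^ 2 * n :=
    Nat.eq_of_mul_eq_mul_left hp (by linarith)
  have hB : B + (q + 1) * n = (q + 1) ^ 3 * n :=
    Nat.eq_of_mul_eq_mul_left (pow_pos hp 2) (by linarith)
  linarith

end IsL2Lift

section Presentation

variable (p : ℕ)

/-- The generator `x` of `L2 p`. -/
def L2.x : L2 p := PresentedGroup.of (rels := L2Rels p) 0

/-- The generator `y` of `L2 p`. -/
def L2.y : L2 p := PresentedGroup.of (rels := L2Rels p) 1

theorem L2.x_pow : L2.x p ^ p ^ 2 = 1 :=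
  PresentedGroup.one_of_mem (rels := L2Rels p) (by simp [L2Rels])

theorem L2.y_mul_x : L2.y p * L2.x p = L2.x p ^ (p + 1) * L2.y p :=
  mul_inv_eq_one.1 (PresentedGroup.one_of_mem (rels := L2Rels p)
    (x := FreeGroup.of 1 * FreeGroup.of 0 * (FreeGroup.of 0 ^ (p + 1) * FreeGroup.of 1)⁻¹)
    (by simp [L2Rels]))

theorem L2.eq_top_of_mem {H : Subgroup (L2 p)} (hx : L2.x p ∈ H) (hy : L2.y p ∈ H) : H = ⊤ := by
  refine top_unique ((PresentedGroup.closure_range_of (L2Rels p)).symm.trans_le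
    ((Subgroup.closure_le H).2 ?_))
  rintro _ ⟨i, rfl⟩
  fin_cases i
  exacts [hx, hy]

variable {p}

/-- `L2 p` acts on `ZMod (p ^ 2)` with `x` translating by `1` and `y` multiplying by `1 + p`. -/
theorem L2.x_pow_ne_one (hp : p.Prime) : L2.x p ^ p ≠ 1 := by
  have hsq : (p : ZMod (p ^ 2)) ^ 2 = 0 := by exact_mod_cast ZMod.natCast_self (p ^ 2)
  let u : (ZMod (p ^ 2))ˣ := ⟨1 + p, 1 - p,
    by linear_combination -hsq, by linear_combination -hsq⟩
  let X : Equiv.Perm (ZMod (p ^ 2)) := Equiv.addLeft 1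
  let Y : Equiv.Perm (ZMod (p ^ 2)) := u.mulLeft
  have hX (n : ℕ) (t : ZMod (p ^ 2)) : (X ^ n) t = n + t := by
    induction n with
    | zero => simp
    | succ n ih =>
      rw [pow_succ' _ n, Equiv.Perm.mul_apply, ih]
      simp only [X, Equiv.coe_addLeft]
      push_cast
      ring
  have hY (n : ℕ) (t : ZMod (p ^ 2)) : (Y ^ n) t = (1 + n * p) * t := by
    induction n with
    | zero => simp
    | succ n ih =>
      rw [pow_succ' _ n, Equiv.Perm.mul_apply, ih]
      simp only [Y, u, Units.mulLeft_apply]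
      push_cast
      linear_combination n * t * hsq
  have hrel : ∀ r ∈ L2Rels p, FreeGroup.lift ![X, Y] r = 1 := by
    rintro r (rfl | rfl | rfl)
    · ext1 t
      simp only [map_pow, FreeGroup.lift_apply_of, Matrix.cons_val_zero]
      rw [hX]
      push_cast
      rw [hsq]
      simp
    · ext1 t
      simp only [map_pow, FreeGroup.lift_apply_of, Matrix.cons_val_one, Matrix.cons_val_zero]
      rw [hY]
      push_cast
      rw [hsq]
      simp
    · rw [map_mul, map_inv, mul_inv_eq_one]
      ext1 t
      simp only [map_mul, map_pow, FreeGroup.lift_apply_of, Matrix.cons_val_zero,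
        Matrix.cons_val_one, Equiv.Perm.mul_apply]
      rw [hX]
      simp only [X, Y, u, Equiv.coe_addLeft, Units.mulLeft_apply]
      push_cast
      ring
  intro h
  let φ : L2 p →* Equiv.Perm (ZMod (p ^ 2)) := PresentedGroup.toGroup hrel
  have h2 : X ^ p = 1 := by
    have h1 := congrArg φ h
    rw [map_pow, map_one] at h1
    exact h1
  have h3 := congrArg (fun e : Equiv.Perm (ZMod (p ^ 2)) => e 0) h2
  simp only [hX, add_zero, Equiv.Perm.one_apply] at h3
  rw [ZMod.natCast_eq_zero_iff] at h3
  have h4 := Nat.le_of_dvd hp.pos h3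
  nlinarith [hp.one_lt]

theorem exists_isL2Lift {G : Type*} [Group G] (hp : p.Prime) (hodd : Odd p)
    (e : (G ⧸ Subgroup.center G) ≃* L2 p) : ∃ a b c : G, IsL2Lift p a b c := by
  let f : G →* L2 p := e.toMonoidHom.comp (QuotientGroup.mk' (Subgroup.center G))
  have hf : Function.Surjective f := e.surjective.comp (QuotientGroup.mk'_surjective _)
  have hker (g : G) : f g = 1 ↔ g ∈ Subgroup.center G := by
    change e (QuotientGroup.mk' _ g) = 1 ↔ _
    rw [map_eq_one_iff e e.injective, ← MonoidHom.mem_ker, QuotientGroup.ker_mk']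
  obtain ⟨a, ha⟩ := hf (L2.x p)
  obtain ⟨b, hb⟩ := hf (L2.y p)
  have hc : b * a * b⁻¹ * (a ^ p * a)⁻¹ ∈ Subgroup.center G := by
    rw [← hker]
    simp only [map_mul, map_inv, map_pow, ha, hb]
    rw [mul_inv_eq_one, mul_inv_eq_iff_eq_mul, L2.y_mul_x, pow_succ]
  have hfc : f (b * a * b⁻¹ * a⁻¹) = L2.x p ^ p := by
    simp only [map_mul, map_inv, ha, hb, L2.y_mul_x, pow_succ]
    group
  refine ⟨a, b, b * a * b⁻¹ * a⁻¹, hp, hodd, ?_, ⟨_, hc, by group⟩, ?_, ?_, ?_⟩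
  · exact semiconjBy_mul_left_iff_commutatorElement_eq.2 (commutatorElement_def b a)
  · rw [← hker, map_pow, hfc, ← pow_mul, ← sq, L2.x_pow]
  · rw [← hker, hfc]
    exact L2.x_pow_ne_one hp
  · intro H haH hbH hZ
    have hmap : H.map f = ⊤ := L2.eq_top_of_mem p ⟨a, haH, ha⟩ ⟨b, hbH, hb⟩
    have hk : f.ker ≤ H := fun g hg => hZ ((hker g).1 hg)
    rw [← Subgroup.comap_map_eq_self hk, hmap, Subgroup.comap_top]

end Presentation

/-- Let `p` be an odd prime and `G` a finite group with `G/Z(G)` isomorphic to the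
nonabelian group `⟨x, y | x^(p²) = y^(p²) = 1, y x = x^(p+1) y⟩`. Then the number of
conjugacy classes of noncentral elements of `G` equals `n·(p - 1)·(p + 1)²` where
`n = |Z|/p`. -/
theorem card_noncentral_conjClasses_nonabelian_quotient {G : Type*} [Group G] [Fintype G]
    (p : ℕ) (hp : p.Prime) (hodd : Odd p)
    (hiso : Nonempty ((G ⧸ Subgroup.center G) ≃* L2 p)) :
    {C : Set G | ∃ x : G, x ∉ Subgroup.center G ∧
        C = {y : G | ∃ g : G, y = g⁻¹ * x * g}}.ncard
      = (Nat.card (Subgroup.center G) / p) * (p - 1) * (p + 1) ^ 2 := by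
  obtain ⟨e⟩ := hiso
  obtain ⟨a, b, c, hL⟩ := exists_isL2Lift hp hodd e
  rw [← hL.ncard_noncentral]
  congr 1
  ext C
  simp [Set.mem_image, eq_comm]
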